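/- arXiv:1004.0454 — 5 statements merged into one kernel-verified Lean document; each statement's English description precedes it below -/
import Mathlib

section
/- For all integers p ≥ 0 and q ≥ 1, the integral ∫₀ᵗ (tanh s)^p (cosh s)^q ds is asymptotically equivalent, as t → +∞, to e^{q t}/(q·2^q); that is, lim_{t→+∞} q·2^q·e^{−q t}·∫₀ᵗ (tanh s)^p (cosh s)^q ds = 1. -/
open MeasureTheory Filter Set Topology

/-- The exponentially weighted averages of a bounded continuous function that converges at
infinity to `L` converge to `L / c`. -/
theorem tendsto_exp_neg_mul_integral_exp_mul {g : ℝ → ℝ} {c C L : ℝ} (hc : 0 < c)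
    (hg : Continuous g) (hC : ∀ s, 0 ≤ s → |g s| ≤ C) (hL : Tendsto g atTop (𝓝 L)) :
    Tendsto (fun t : ℝ => Real.exp (-(c * t)) * ∫ s in (0 : ℝ)..t, Real.exp (c * s) * g s)
      atTop (𝓝 (L / c)) := by
  have hlim : Tendsto
      (fun t : ℝ => ∫ u in Ioi (0 : ℝ),
        (Iic t).indicator (fun u => Real.exp (-c * u) * g (t - u)) u)
      atTop (𝓝 (∫ u in Ioi (0 : ℝ), Real.exp (-c * u) * L)) := by
    refine tendsto_integral_filter_of_dominated_convergence (fun u => Real.exp (-c * u) * C)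
      ?_ ?_ ((integrableOn_exp_mul_Ioi (neg_lt_zero.mpr hc) 0).mul_const C) ?_
    · refine Eventually.of_forall fun t => ?_
      exact ((by fun_prop : Continuous fun u => Real.exp (-c * u) * g (t - u)).measurable.indicator
        measurableSet_Iic).aestronglyMeasurable
    · refine Eventually.of_forall fun t => Eventually.of_forall fun u => ?_
      have hC0 : 0 ≤ C := (abs_nonneg _).trans (hC 0 le_rfl)
      by_cases hu : u ∈ Iic t
      · rw [indicator_of_mem hu, norm_mul, Real.norm_eq_abs, Real.norm_eq_abs, Real.abs_exp]
        exact mul_le_mul_of_nonneg_left (hC _ (sub_nonneg.mpr hu)) (Real.exp_pos _).le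
      · rw [indicator_of_notMem hu, norm_zero]
        positivity
    · refine Eventually.of_forall fun u => ?_
      have h : Tendsto (fun t => Real.exp (-c * u) * g (t - u)) atTop
          (𝓝 (Real.exp (-c * u) * L)) :=
        (hL.comp (tendsto_atTop_add_const_right _ (-u) tendsto_id)).const_mul _
      refine h.congr' ?_
      filter_upwards [eventually_ge_atTop u] with t ht
      rw [indicator_of_mem (mem_Iic.mpr ht)]
  have hval : ∫ u in Ioi (0 : ℝ), Real.exp (-c * u) * L = L / c := by
    rw [integral_mul_const, integral_exp_mul_Ioi (neg_lt_zero.mpr hc)]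
    simp
    field_simp
  rw [hval] at hlim
  refine hlim.congr' ?_
  filter_upwards [eventually_ge_atTop 0] with t ht
  rw [setIntegral_indicator measurableSet_Iic, Ioi_inter_Iic,
    ← intervalIntegral.integral_of_le ht, ← intervalIntegral.integral_const_mul]
  have h := intervalIntegral.integral_comp_sub_left (a := 0) (b := t)
    (fun s => Real.exp (-(c * t)) * (Real.exp (c * s) * g s)) t
  rw [sub_self, sub_zero] at h
  rw [← h]
  refine intervalIntegral.integral_congr fun u _ => ?_
  rw [← mul_assoc, ← Real.exp_add]
  ring_nf

theorem tendsto_exp_neg_two_mul_atTop :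
    Tendsto (fun s : ℝ => Real.exp (-(2 * s))) atTop (𝓝 0) :=
  Real.tendsto_exp_neg_atTop_nhds_zero.comp (tendsto_id.const_mul_atTop two_pos)

theorem cosh_mul_exp_neg (s : ℝ) :
    Real.cosh s * Real.exp (-s) = (1 + Real.exp (-(2 * s))) / 2 := by
  have h : Real.exp s * Real.exp (-s) = 1 := by rw [← Real.exp_add]; simp
  have h' : Real.exp (-(2 * s)) = Real.exp (-s) * Real.exp (-s) := by
    rw [← Real.exp_add]; ring_nf
  rw [Real.cosh_eq, h']
  linear_combination h / 2

theorem tanh_eq_exp_neg_two_mul (s : ℝ) :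
    Real.tanh s = (1 - Real.exp (-(2 * s))) / (1 + Real.exp (-(2 * s))) := by
  have h : Real.exp s * Real.exp (-s) = 1 := by rw [← Real.exp_add]; simp
  have h' : Real.exp (-(2 * s)) = Real.exp (-s) * Real.exp (-s) := by
    rw [← Real.exp_add]; ring_nf
  rw [Real.tanh_eq, h', div_eq_div_iff (by positivity) (by positivity)]
  linear_combination (2 * Real.exp (-s)) * h

theorem tendsto_cosh_mul_exp_neg_atTop :
    Tendsto (fun s : ℝ => Real.cosh s * Real.exp (-s)) atTop (𝓝 (1 / 2)) := by
  simp only [cosh_mul_exp_neg]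
  simpa using (tendsto_exp_neg_two_mul_atTop.const_add 1).div_const 2

theorem tendsto_tanh_atTop : Tendsto Real.tanh atTop (𝓝 1) := by
  have h := (tendsto_exp_neg_two_mul_atTop.const_sub 1).div
    (tendsto_exp_neg_two_mul_atTop.const_add 1) (by norm_num)
  simpa [funext tanh_eq_exp_neg_two_mul, Pi.div_def] using h

theorem continuous_real_tanh : Continuous Real.tanh := by
  simp only [funext Real.tanh_eq_sinh_div_cosh]
  exact Real.continuous_sinh.div Real.continuous_cosh fun s => (Real.cosh_pos s).ne'

/-- For all integers `p ≥ 0` and `q ≥ 1`, the integral `∫₀ᵗ (tanh s)^p (cosh s)^q ds` is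
asymptotically equivalent, as `t → +∞`, to `e^{q t} / (q 2^q)`; i.e.
`q 2^q e^{-q t} ∫₀ᵗ (tanh s)^p (cosh s)^q ds → 1`. -/
theorem stmt1 (p q : ℕ) (hq : 1 ≤ q) :
    Filter.Tendsto
      (fun t : ℝ => (q : ℝ) * 2 ^ q * Real.exp (-((q : ℝ) * t)) *
        ∫ s in (0 : ℝ)..t, Real.tanh s ^ p * Real.cosh s ^ q)
      Filter.atTop (nhds 1) := by
  have hq0 : (0 : ℝ) < q := by exact_mod_cast hq
  have hcont : Continuous fun s : ℝ =>
      Real.tanh s ^ p * (Real.cosh s * Real.exp (-s)) ^ q :=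
    (continuous_real_tanh.pow p).mul
      ((Real.continuous_cosh.mul (Real.continuous_exp.comp continuous_neg)).pow q)
  have hbound : ∀ s : ℝ, 0 ≤ s →
      |Real.tanh s ^ p * (Real.cosh s * Real.exp (-s)) ^ q| ≤ 1 := by
    intro s hs
    rw [abs_mul, abs_pow, abs_pow]
    refine mul_le_one₀ (pow_le_one₀ (abs_nonneg _) (Real.abs_tanh_lt_one s).le) (by positivity)
      (pow_le_one₀ (abs_nonneg _) ?_)
    have h : Real.exp (-(2 * s)) ≤ 1 := Real.exp_le_one_iff.mpr (by linarith)
    rw [cosh_mul_exp_neg, abs_of_pos (by positivity)]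
    linarith
  have hlim := (tendsto_exp_neg_mul_integral_exp_mul hq0 hcont hbound
    ((tendsto_tanh_atTop.pow p).mul (tendsto_cosh_mul_exp_neg_atTop.pow q))).const_mul
      ((q : ℝ) * 2 ^ q)
  have hone : (q : ℝ) * 2 ^ q * (1 ^ p * (1 / 2) ^ q / q) = 1 := by
    rw [one_pow, one_div, inv_pow]
    field_simp
  rw [hone] at hlim
  refine hlim.congr fun t => ?_
  rw [← mul_assoc]
  congr 1
  refine intervalIntegral.integral_congr fun s _ => ?_
  have h : Real.exp (q * s) * Real.exp (-s) ^ q = 1 := by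
    rw [← Real.exp_nat_mul, ← Real.exp_add]; simp
  simp only [mul_pow]
  linear_combination (Real.tanh s ^ p * Real.cosh s ^ q) * h
end

section
/- Let Q(X,Y) = A X² + B X Y + C Y² be an integral binary quadratic form which is indefinite and irreducible, and let γ = ±(a,b;c,d) ∈ PSL₂(ℤ). Then h(γ·α_Q) = (|Q(d,−c)|/|A|)·h(α_Q) = (2/√(D_Q))·|Q(d,−c)|. -/
/-- The action of `SL(2,ℤ)` (through `PSL(2,ℤ)`) on `ℝ` by Möbius transformations
`±(a, b; c, d) · x = (a x + b) / (c x + d)`. -/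
noncomputable def mobius (g : Matrix.SpecialLinearGroup (Fin 2) ℤ) (x : ℝ) : ℝ :=
  ((g.1 0 0 : ℝ) * x + (g.1 0 1 : ℝ)) / ((g.1 1 0 : ℝ) * x + (g.1 1 1 : ℝ))

/-- `α_Q = (-B + √(D_Q)) / (2A)`. -/
noncomputable def alphaQ (A B C : ℤ) : ℝ :=
  (-(B : ℝ) + Real.sqrt ((B ^ 2 - 4 * A * C : ℤ) : ℝ)) / (2 * (A : ℝ))

/-- The Galois conjugate `(α_Q)^σ = (-B - √(D_Q)) / (2A)` of `α_Q`. -/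
noncomputable def alphaQconj (A B C : ℤ) : ℝ :=
  (-(B : ℝ) - Real.sqrt ((B ^ 2 - 4 * A * C : ℤ) : ℝ)) / (2 * (A : ℝ))

/-- A binary quadratic form of non-square discriminant has no nontrivial integral zero. -/
theorem quadForm_ne_zero {A B C : ℤ} (hirred : ¬ IsSquare (B ^ 2 - 4 * A * C)) {c d : ℤ}
    (hcd : c ≠ 0 ∨ d ≠ 0) : A * d ^ 2 - B * d * c + C * c ^ 2 ≠ 0 := by
  intro h
  have hA : A ≠ 0 := by
    rintro rfl
    exact hirred ⟨B, by ring⟩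
  have hsq : (2 * A * d - B * c) ^ 2 = c ^ 2 * (B ^ 2 - 4 * A * C) := by
    linear_combination 4 * A * h
  have hc : c ≠ 0 := by
    rintro rfl
    simp_all
  obtain ⟨k, hk⟩ := (Int.pow_dvd_pow_iff two_ne_zero).mp (Dvd.intro _ hsq.symm)
  rw [hk, mul_pow] at hsq
  exact hirred ⟨k, by rw [← mul_left_cancel₀ (pow_ne_zero 2 hc) hsq, sq]⟩

/-- The two roots of `A X² + B X + C` differ by `√D / A`. -/
theorem alphaQ_sub_alphaQconj {A : ℤ} (hA : A ≠ 0) (B C : ℤ) :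
    alphaQ A B C - alphaQconj A B C = Real.sqrt ((B ^ 2 - 4 * A * C : ℤ) : ℝ) / A := by
  have hA' : (A : ℝ) ≠ 0 := by exact_mod_cast hA
  unfold alphaQ alphaQconj
  field_simp
  ring

/-- The form `Q(d, -c)` factors over the roots of `Q`. -/
theorem mul_denom_alphaQ_eq {A B C : ℤ} (hA : A ≠ 0) (hD : 0 ≤ B ^ 2 - 4 * A * C) (c d : ℤ) :
    A * ((c * alphaQ A B C + d) * (c * alphaQconj A B C + d)) =
      ((A * d ^ 2 - B * d * c + C * c ^ 2 : ℤ) : ℝ) := by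
  have hA' : (A : ℝ) ≠ 0 := by exact_mod_cast hA
  have hs := Real.sq_sqrt (show (0 : ℝ) ≤ ((B ^ 2 - 4 * A * C : ℤ) : ℝ) by exact_mod_cast hD)
  unfold alphaQ alphaQconj
  generalize Real.sqrt ((B ^ 2 - 4 * A * C : ℤ) : ℝ) = s at hs ⊢
  push_cast at hs ⊢
  field_simp
  linear_combination -(c : ℝ) ^ 2 * hs

/-- A Möbius transformation of determinant one scales differences by the denominators. -/
theorem mobius_sub_mobius (g : Matrix.SpecialLinearGroup (Fin 2) ℤ) {x y : ℝ}
    (hx : (g.1 1 0 : ℝ) * x + g.1 1 1 ≠ 0) (hy : (g.1 1 0 : ℝ) * y + g.1 1 1 ≠ 0) :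
    mobius g x - mobius g y =
      (x - y) / (((g.1 1 0 : ℝ) * x + g.1 1 1) * ((g.1 1 0 : ℝ) * y + g.1 1 1)) := by
  have hdet : (g.1 0 0 : ℝ) * g.1 1 1 - g.1 0 1 * g.1 1 0 = 1 := by
    have h := g.2
    rw [Matrix.det_fin_two] at h
    exact_mod_cast h
  unfold mobius
  rw [div_sub_div _ _ hx hy]
  congr 1
  linear_combination (x - y) * hdet

/-- Let `Q(X,Y) = A X² + B X Y + C Y²` be an indefinite irreducible integral binary quadratic
form and `γ = ±(a, b; c, d) ∈ PSL₂(ℤ)`. Since the Möbius action commutes with Galois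
conjugation, `h(γ·α_Q) = 2 / |γ·α_Q - γ·(α_Q)^σ|`; this equals
`(|Q(d, -c)| / |A|) · h(α_Q) = (2 / √(D_Q)) · |Q(d, -c)|`. -/
theorem stmt5 (A B C : ℤ) (hindef : 0 < B ^ 2 - 4 * A * C)
    (hirred : ¬ IsSquare (B ^ 2 - 4 * A * C))
    (g : Matrix.SpecialLinearGroup (Fin 2) ℤ) :
    2 / |mobius g (alphaQ A B C) - mobius g (alphaQconj A B C)| =
      (|(A * (g.1 1 1) ^ 2 - B * (g.1 1 1) * (g.1 1 0) + C * (g.1 1 0) ^ 2 : ℤ)| : ℝ) /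
        |(A : ℝ)| * (2 / |alphaQ A B C - alphaQconj A B C|) ∧
    2 / |mobius g (alphaQ A B C) - mobius g (alphaQconj A B C)| =
      2 / Real.sqrt ((B ^ 2 - 4 * A * C : ℤ) : ℝ) *
        (|(A * (g.1 1 1) ^ 2 - B * (g.1 1 1) * (g.1 1 0) + C * (g.1 1 0) ^ 2 : ℤ)| : ℝ) := by
  have hA : A ≠ 0 := by
    rintro rfl
    exact hirred ⟨B, by ring⟩
  have hA' : (A : ℝ) ≠ 0 := by exact_mod_cast hA
  have hcd : g.1 1 0 ≠ 0 ∨ g.1 1 1 ≠ 0 := by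
    by_contra! h
    have hdet := g.2
    rw [Matrix.det_fin_two, h.1, h.2] at hdet
    simp at hdet
  have hq := quadForm_ne_zero hirred hcd
  have hfac := mul_denom_alphaQ_eq hA hindef.le (g.1 1 0) (g.1 1 1)
  generalize A * (g.1 1 1) ^ 2 - B * (g.1 1 1) * (g.1 1 0) + C * (g.1 1 0) ^ 2 = q at hq hfac ⊢
  have hq' : (q : ℝ) ≠ 0 := by exact_mod_cast hq
  have hs : 0 < Real.sqrt ((B ^ 2 - 4 * A * C : ℤ) : ℝ) :=
    Real.sqrt_pos.mpr (by exact_mod_cast hindef)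
  have hprod := right_ne_zero_of_mul (hfac ▸ hq')
  have hdiff : mobius g (alphaQ A B C) - mobius g (alphaQconj A B C) =
      Real.sqrt ((B ^ 2 - 4 * A * C : ℤ) : ℝ) / q := by
    rw [mobius_sub_mobius g (left_ne_zero_of_mul hprod) (right_ne_zero_of_mul hprod),
      alphaQ_sub_alphaQconj hA, div_div, hfac]
  have hqa := abs_ne_zero.mpr hq'
  have hAa := abs_ne_zero.mpr hA'
  rw [hdiff, alphaQ_sub_alphaQconj hA, abs_div, abs_div, abs_of_pos hs]
  constructor <;> field_simp
end

section
/- Let Q be a primitive indefinite integral binary quadratic form of non-square discriminant. Then Q is equivalent to −Q under the action of SL₂(ℤ) if and only if the Galois conjugate (α_Q)^σ lies in the PSL₂(ℤ)-orbit of α_Q under Möbius transformations. -/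
/-- The right action of `SL(2,ℤ)` on binary quadratic forms,
`(Q ∘ γ)(X, Y) = Q(aX + bY, cX + dY)`, written out on the coefficients `(A, B, C)`. -/
def formComp (A B C : ℤ) (g : Matrix.SpecialLinearGroup (Fin 2) ℤ) : ℤ × ℤ × ℤ :=
  (A * (g.1 0 0) ^ 2 + B * (g.1 0 0) * (g.1 1 0) + C * (g.1 1 0) ^ 2,
   2 * A * (g.1 0 0) * (g.1 0 1) + B * ((g.1 0 0) * (g.1 1 1) + (g.1 0 1) * (g.1 1 0))
     + 2 * C * (g.1 1 0) * (g.1 1 1),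
   A * (g.1 0 1) ^ 2 + B * (g.1 0 1) * (g.1 1 1) + C * (g.1 1 1) ^ 2)

/-- The square root of a positive nonsquare integer is linearly independent of `1` over `ℤ`. -/
theorem int_add_mul_sqrt_eq_zero {D : ℤ} (hD : 0 < D) (hsq : ¬ IsSquare D) {x y : ℤ}
    (h : (x : ℝ) + y * Real.sqrt (D : ℝ) = 0) : x = 0 ∧ y = 0 := by
  have hs : Real.sqrt (D : ℝ) ^ 2 = D := Real.sq_sqrt (by exact_mod_cast hD.le)
  have hxy : x ^ 2 = y ^ 2 * D := by
    have : (x : ℝ) ^ 2 = y ^ 2 * D := by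
      rw [← hs]
      linear_combination (x - y * Real.sqrt (D : ℝ)) * h
    exact_mod_cast this
  have hy : y = 0 := by
    by_contra hy
    obtain ⟨k, rfl⟩ : y ∣ x := (Int.pow_dvd_pow_iff two_ne_zero).1 ⟨D, hxy⟩
    refine hsq ⟨k, mul_left_cancel₀ (pow_ne_zero 2 hy) ?_⟩
    linear_combination -hxy
  refine ⟨?_, hy⟩
  simpa [hy] using hxy

/-- An integral matrix sends `α_Q` to its conjugate exactly when it has trace zero and its entries
satisfy one linear relation with the coefficients of `Q`. -/
theorem mobius_alphaQ_eq_alphaQconj_iff {A B C : ℤ} (hindef : 0 < B ^ 2 - 4 * A * C)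
    (hirred : ¬ IsSquare (B ^ 2 - 4 * A * C)) (g : Matrix.SpecialLinearGroup (Fin 2) ℤ) :
    mobius g (alphaQ A B C) = alphaQconj A B C ↔
      g.1 0 0 + g.1 1 1 = 0 ∧ A * g.1 0 1 - C * g.1 1 0 = g.1 0 0 * B := by
  have hdet := g.2
  rw [Matrix.det_fin_two] at hdet
  unfold mobius alphaQ alphaQconj
  generalize g.1 0 0 = a at *
  generalize g.1 0 1 = b at *
  generalize g.1 1 0 = c at *
  generalize g.1 1 1 = d at *
  have hA : A ≠ 0 := by
    rintro rfl
    exact hirred ⟨B, by ring⟩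
  have hAR : (A : ℝ) ≠ 0 := by exact_mod_cast hA
  have hs : Real.sqrt ((B ^ 2 - 4 * A * C : ℤ) : ℝ) ^ 2 = B ^ 2 - 4 * A * C := by
    rw [Real.sq_sqrt (by exact_mod_cast hindef.le)]
    push_cast
    ring
  have hind := @int_add_mul_sqrt_eq_zero _ hindef hirred
  generalize Real.sqrt ((B ^ 2 - 4 * A * C : ℤ) : ℝ) = s at *
  have hden : (c : ℝ) * ((-B + s) / (2 * A)) + d ≠ 0 := by
    intro h
    field_simp at h
    obtain ⟨h1, h2⟩ := @hind (2 * A * d - c * B) c (by push_cast; linear_combination h)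
    have hd : d = 0 := by simpa [h2, hA] using h1
    simp [h2, hd] at hdet
  rw [div_eq_iff hden]
  constructor
  · intro h
    field_simp at h
    have h' : ((2 * A * b - a * B - 2 * C * c + d * B : ℤ) : ℝ) + ((a + d : ℤ) : ℝ) * s = 0 := by
      have h2A : (2 * A : ℝ) ≠ 0 := by positivity
      apply mul_left_cancel₀ h2A
      push_cast
      linear_combination h - c * hs
    obtain ⟨h1, h2⟩ := hind h'
    exact ⟨h2, by linarith [congrArg (· * B) h2]⟩
  · rintro ⟨h1, h2⟩
    have h1' : (a : ℝ) + d = 0 := by exact_mod_cast h1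
    have h2' : (A : ℝ) * b - C * c = a * B := by exact_mod_cast h2
    field_simp
    linear_combination 2 * A * (B + s) * h1' + 4 * A * h2' + c * hs

/-- An element of `SL(2,ℤ)` sends `Q` to `-Q` exactly when it has trace zero and its entries
satisfy one linear relation with the coefficients of `Q`. -/
theorem formComp_eq_neg_iff {A B C : ℤ} (hA : A ≠ 0) (g : Matrix.SpecialLinearGroup (Fin 2) ℤ) :
    formComp A B C g = (-A, -B, -C) ↔
      g.1 0 0 + g.1 1 1 = 0 ∧ A * g.1 0 1 - C * g.1 1 0 = g.1 0 0 * B := by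
  have hdet := g.2
  rw [Matrix.det_fin_two] at hdet
  simp only [formComp, Prod.mk.injEq]
  generalize g.1 0 0 = a at *
  generalize g.1 0 1 = b at *
  generalize g.1 1 0 = c at *
  generalize g.1 1 1 = d at *
  constructor
  · rintro ⟨e1, e2, e3⟩
    have htr : a + d = 0 := by
      apply mul_left_cancel₀ (mul_ne_zero two_ne_zero hA)
      linear_combination 2 * d * e1 - c * e2 - (2 * A * a + B * c) * hdet
    refine ⟨htr, mul_left_cancel₀ (two_ne_zero (α := ℤ)) ?_⟩
    linear_combination d * e2 - 2 * c * e3 - (2 * A * b + B * d) * hdet - 2 * B * htr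
  · rintro ⟨h1, h2⟩
    obtain rfl : d = -a := by linarith
    refine ⟨?_, ?_, ?_⟩
    · linear_combination -c * h2 - A * hdet
    · linear_combination 2 * a * h2 - B * hdet
    · linear_combination b * h2 - C * hdet

/-- Let `Q = A X² + B X Y + C Y²` be a primitive indefinite integral binary quadratic form of
non-square discriminant. Then `Q` is `SL₂(ℤ)`-equivalent to `-Q` if and only if the Galois
conjugate `(α_Q)^σ` lies in the `PSL₂(ℤ)`-orbit of `α_Q` under Möbius transformations. -/
theorem stmt8 (A B C : ℤ) (hprim : Int.gcd A (Int.gcd B C) = 1)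
    (hindef : 0 < B ^ 2 - 4 * A * C) (hirred : ¬ IsSquare (B ^ 2 - 4 * A * C)) :
    (∃ g : Matrix.SpecialLinearGroup (Fin 2) ℤ, formComp A B C g = (-A, -B, -C)) ↔
      (∃ g : Matrix.SpecialLinearGroup (Fin 2) ℤ,
        mobius g (alphaQ A B C) = alphaQconj A B C) := by
  have hA : A ≠ 0 := by
    rintro rfl
    exact hirred ⟨B, by ring⟩
  exact exists_congr fun g =>
    (formComp_eq_neg_iff hA g).trans (mobius_alphaQ_eq_alphaQconj_iff hindef hirred g).symm
end

section
/- Let α be a real quadratic irrational which is an algebraic integer. Then its Galois conjugate α^σ lies in the PSL₂(ℤ)-orbit of α under Möbius transformations if and only if the order ℤ + αℤ contains an element of norm −1 (i.e. there exist integers a and c with N(cα − a) = −1). -/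
/-- An integral linear relation between `1` and an irrational number is trivial. -/
theorem Irrational.eq_zero_and_eq_zero_of_intCast_mul_add {x : ℝ} (hx : Irrational x) {u v : ℤ}
    (h : (u : ℝ) * x + v = 0) : u = 0 ∧ v = 0 := by
  have hu : u = 0 := by
    by_contra hu
    exact ((hx.intCast_mul hu).add_intCast v).ne_zero h
  subst hu
  exact ⟨rfl, by simpa using h⟩

/-- Let `α` be a real quadratic irrational which is an algebraic integer: `α` is irrational and
`α² = t α - n` with `t = Tr(α), n = N(α) ∈ ℤ`; its Galois conjugate is `α^σ = t - α`. Then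
`α^σ` lies in the `PSL₂(ℤ)`-orbit of `α` under Möbius transformations if and only if the order
`ℤ + αℤ` contains an element of norm `-1`, i.e. there exist integers `a` and `c` with
`N(cα - a) = (cα - a)(cα^σ - a) = -1`. -/
theorem stmt9 (α : ℝ) (hirr : Irrational α) (t n : ℤ)
    (hquad : α ^ 2 = (t : ℝ) * α - (n : ℝ)) :
    (∃ g : Matrix.SpecialLinearGroup (Fin 2) ℤ, mobius g α = (t : ℝ) - α) ↔
      (∃ a c : ℤ, ((c : ℝ) * α - (a : ℝ)) * ((c : ℝ) * ((t : ℝ) - α) - (a : ℝ)) = -1) := by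
  constructor
  · rintro ⟨g, hg⟩
    have hdet := g.2
    rw [Matrix.det_fin_two] at hdet
    unfold mobius at hg
    generalize g.1 0 0 = p at hg hdet
    generalize g.1 0 1 = q at hg hdet
    generalize g.1 1 0 = r at hg hdet
    generalize g.1 1 1 = s at hg hdet
    have hden : (r : ℝ) * α + s ≠ 0 := by
      intro h
      rw [h, div_zero] at hg
      exact (hirr.intCast_sub t).ne_zero hg.symm
    rw [div_eq_iff hden] at hg
    obtain ⟨hp, hq⟩ := hirr.eq_zero_and_eq_zero_of_intCast_mul_add
      (u := p + s) (v := q - r * n - s * t) (by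
        push_cast
        linear_combination hg - (r : ℝ) * hquad)
    refine ⟨-s, r, ?_⟩
    have hnorm : r ^ 2 * n + r * s * t + s ^ 2 = -1 := by
      linear_combination -hdet + s * hp - r * hq
    have hnormR : (r : ℝ) ^ 2 * n + r * s * t + s ^ 2 = -1 := by exact_mod_cast hnorm
    push_cast
    linear_combination hnormR - (r : ℝ) ^ 2 * hquad
  · rintro ⟨a, c, h⟩
    have hnorm : a * -a - (c * n - a * t) * c = 1 := by
      have hnormR : (a : ℝ) * -a - (c * n - a * t) * c = 1 := by
        linear_combination -h - (c : ℝ) ^ 2 * hquad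
      exact_mod_cast hnormR
    have hden : (c : ℝ) * α + -a ≠ 0 := by
      intro h0
      rw [sub_eq_add_neg, h0, zero_mul] at h
      norm_num at h
    refine ⟨⟨!![a, c * n - a * t; c, -a], by rw [Matrix.det_fin_two_of]; exact hnorm⟩, ?_⟩
    simp only [mobius, Matrix.of_apply, Matrix.cons_val_zero, Matrix.cons_val_one,
      Matrix.cons_val', Matrix.cons_val_fin_one]
    push_cast
    rw [div_eq_iff hden]
    linear_combination (c : ℝ) * hquad
end

section
/- Let φ = (1+√5)/2 be the golden ratio and φ^σ = (1−√5)/2, and let K be an imaginary quadratic number field with discriminant D ≠ −4 and ring of integers 𝒪_D. For a nonzero ideal 𝔞 of 𝒪_D, let Γ₀(𝔞) = {±(a,b;c,d) ∈ PSL₂(𝒪_D) : c ∈ 𝔞}. Then there exists g ∈ Γ₀(2𝒪_D) with g·φ = φ^σ, but there is no g ∈ Γ₀(3𝒪_D) with g·φ = φ^σ; i.e. φ is Γ₀(2𝒪_D)-reciprocal but not Γ₀(3𝒪_D)-reciprocal. -/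
open NumberField

/-- `SL₂` of the ring of integers of a subfield `K` of `ℂ`. -/
abbrev SL2O (K : Subfield ℂ) := Matrix.SpecialLinearGroup (Fin 2) (𝓞 ↥K)

/-- The action of `SL₂(𝒪_K)` (through `PSL₂(𝒪_K)`) on `ℂ` by Möbius transformations. -/
noncomputable def mobiusC {K : Subfield ℂ} (g : SL2O K) (z : ℂ) : ℂ :=
  (((g.1 0 0 : ↥K) : ℂ) * z + ((g.1 0 1 : ↥K) : ℂ)) /
    (((g.1 1 0 : ↥K) : ℂ) * z + ((g.1 1 1 : ↥K) : ℂ))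

/-- The golden ratio `φ = (1 + √5)/2`, as a complex number. -/
noncomputable def phiC : ℂ := (((1 + Real.sqrt 5) / 2 : ℝ) : ℂ)

/-- The Galois conjugate `φ^σ = (1 - √5)/2` of the golden ratio over `K`. -/
noncomputable def phiCσ : ℂ := (((1 - Real.sqrt 5) / 2 : ℝ) : ℂ)

/-- An imaginary quadratic field has exactly two complex embeddings, so the norm of `x` is
`|x|²`. -/
lemma normSq_eq_norm (K : Subfield ℂ) [NumberField ↥K]
    (hdeg : Module.finrank ℚ ↥K = 2) (himag : ∃ z ∈ K, Complex.im z ≠ 0) (x : ↥K) :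
    Complex.normSq (x : ℂ) = ((Algebra.norm ℚ x : ℚ) : ℝ) := by
  classical
  let s : ↥K →ₐ[ℚ] ℂ := K.subtype.toRatAlgHom
  let t : ↥K →ₐ[ℚ] ℂ := ((starRingEnd ℂ).comp K.subtype).toRatAlgHom
  have hst : s ≠ t := by
    obtain ⟨z, hz, him⟩ := himag
    intro h
    have h1 : z = starRingEnd ℂ z := DFunLike.congr_fun h (⟨z, hz⟩ : ↥K)
    exact him (Complex.conj_eq_iff_im.mp h1.symm)
  have huniv : (Finset.univ : Finset (↥K →ₐ[ℚ] ℂ)) = {s, t} := by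
    symm
    apply Finset.eq_univ_of_card
    rw [Finset.card_pair hst, AlgHom.card, hdeg]
  have h := Algebra.norm_eq_prod_embeddings ℚ ℂ x
  rw [huniv, Finset.prod_pair hst] at h
  have h2 : s x * t x = (Complex.normSq (x : ℂ) : ℂ) := Complex.mul_conj (x : ℂ)
  rw [h2, eq_ratCast] at h
  exact_mod_cast h.symm

lemma exists_int_normSq (K : Subfield ℂ) [NumberField ↥K]
    (hdeg : Module.finrank ℚ ↥K = 2) (himag : ∃ z ∈ K, Complex.im z ≠ 0) (x : 𝓞 ↥K) :
    ∃ n : ℤ, Complex.normSq ((x : ↥K) : ℂ) = n := by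
  refine ⟨Algebra.norm ℤ x, ?_⟩
  rw [normSq_eq_norm K hdeg himag, ← Algebra.coe_norm_int, Rat.cast_intCast]

/-- A quadratic field containing a square root of `-1` has discriminant `-4`. -/
lemma discr_eq_neg_four_of_sq_eq_neg_one (K : Type*) [Field K] [NumberField K]
    (hdeg : Module.finrank ℚ K = 2) (i : K) (hi : i ^ 2 = -1) : NumberField.discr K = -4 := by
  have hprim : IsPrimitiveRoot i (2 ^ (1 + 1)) := by
    rw [IsPrimitiveRoot.iff_orderOf]
    apply orderOf_eq_prime_pow
    · norm_num [hi]
    · show i ^ 4 = 1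
      linear_combination (i ^ 2 - 1) * hi
  have htop : Algebra.adjoin ℚ {i} = ⊤ := by
    have := Subalgebra.isSimpleOrder_of_finrank_prime ℚ K (hdeg ▸ Nat.prime_two)
    refine (eq_bot_or_eq_top _).resolve_left fun h => ?_
    have hmem : i ∈ (⊥ : Subalgebra ℚ K) := h ▸ Algebra.self_mem_adjoin_singleton ℚ i
    obtain ⟨q, hq⟩ := Algebra.mem_bot.mp hmem
    have h1 : algebraMap ℚ K (q ^ 2) = algebraMap ℚ K (-1) := by
      rw [map_pow, hq, hi, map_neg, map_one]
    have h2 := (algebraMap ℚ K).injective h1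
    nlinarith [sq_nonneg q]
  have hcyc : IsCyclotomicExtension {2 ^ (1 + 1)} ℚ K := by
    rw [IsCyclotomicExtension.iff_singleton]
    refine ⟨⟨i, hprim⟩, fun x => ?_⟩
    have hx : x ∈ Algebra.adjoin ℚ {i} := htop ▸ Algebra.mem_top
    refine Algebra.adjoin_mono ?_ hx
    rintro _ rfl
    exact hprim.pow_eq_one
  have := Fact.mk Nat.prime_two
  rw [IsCyclotomicExtension.Rat.discr_prime_pow_succ 2 1 K]
  norm_num

/-- If `d + cφ` has relative norm `-1` over `K` and its relative norm `A + Bφ` to `ℚ(√5)` satisfies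
`3 ∣ B`, then multiplying by powers of `φ²` reduces `d + cφ` to a square root of `-1` in `K`. -/
lemma exists_sq_eq_neg_one (K : Subfield ℂ)
    (hint : ∀ x : 𝓞 ↥K, ∃ n : ℤ, Complex.normSq ((x : ↥K) : ℂ) = n)
    (N : ℕ) : ∀ (c d : 𝓞 ↥K) (A B : ℤ), d ^ 2 + c * d - c ^ 2 = -1 →
      Complex.normSq ((d : ↥K) : ℂ) + Complex.normSq ((c : ↥K) : ℂ) = A →
      Complex.normSq (((c + d : 𝓞 ↥K) : ↥K) : ℂ) - Complex.normSq ((d : ↥K) : ℂ) = B →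
      3 ∣ B → B.natAbs = N → ∃ e : 𝓞 ↥K, e ^ 2 = -1 := by
  induction N using Nat.strong_induction_on with
  | _ N ih =>
  intro c d A B h hA hB h3 hN
  have hC : ((d : ↥K) : ℂ) ^ 2 + ((c : ↥K) : ℂ) * ((d : ↥K) : ℂ) - ((c : ↥K) : ℂ) ^ 2 = -1 := by
    exact_mod_cast congrArg (fun x : 𝓞 ↥K => ((x : ↥K) : ℂ)) h
  have hA0 : 0 ≤ A := by
    have : (0 : ℝ) ≤ A := hA ▸ add_nonneg (Complex.normSq_nonneg _) (Complex.normSq_nonneg _)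
    exact_mod_cast this
  have hAB : A ^ 2 + A * B - B ^ 2 = 1 := by
    have h1 := congrArg Complex.normSq hC
    have h2 : (A : ℝ) ^ 2 + A * B - B ^ 2 = 1 := by
      rw [← hA, ← hB]
      simp only [Complex.normSq_neg, Complex.normSq_one] at h1
      rw [← h1]
      simp only [Complex.normSq_apply, pow_two, map_add, Subfield.coe_add, Complex.add_re,
        Complex.add_im, Complex.sub_re, Complex.sub_im, Complex.mul_re, Complex.mul_im]
      ring
    exact_mod_cast h2
  have h2 : (((2 : 𝓞 ↥K) : ↥K) : ℂ) = 2 := by norm_cast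
  rcases lt_trichotomy B 0 with hneg | hzero | hpos
  · have hB3 : B ≤ -3 := by omega
    refine ih (3 * A + 5 * B).natAbs ?_ (d + 2 * c) (d + c) (2 * A + 3 * B) (3 * A + 5 * B)
      (by linear_combination h) ?_ ?_ (by omega) rfl
    · have : A < -2 * B := by nlinarith
      have : -4 * B < 3 * A := by nlinarith
      omega
    · push_cast
      rw [← hA, ← hB]
      simp [Complex.normSq_apply, h2]
      ring
    · push_cast
      rw [← hA, ← hB]
      simp [Complex.normSq_apply, h2]
      ring
  · subst hzero
    have hA1 : A = 1 := by nlinarith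
    subst hA1
    obtain ⟨m, hm⟩ := hint d
    obtain ⟨n, hn⟩ := hint c
    have hm0 : 0 ≤ m := by
      have := Complex.normSq_nonneg ((d : ↥K) : ℂ)
      rw [hm] at this
      exact_mod_cast this
    have hn0 : 0 ≤ n := by
      have := Complex.normSq_nonneg ((c : ↥K) : ℂ)
      rw [hn] at this
      exact_mod_cast this
    have hmn : m + n = 1 := by
      rw [hm, hn] at hA
      exact_mod_cast hA
    rcases (by omega : n = 0 ∨ m = 0) with rfl | rfl
    · have hc : c = 0 := by
        have := Complex.normSq_eq_zero.mp (hn.trans Int.cast_zero)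
        exact_mod_cast this
      refine ⟨d, ?_⟩
      rw [hc] at h
      linear_combination h
    · exfalso
      have hd : d = 0 := by
        have := Complex.normSq_eq_zero.mp (hm.trans Int.cast_zero)
        exact_mod_cast this
      rw [hm, hd, add_zero, hn] at hB
      have : n = 0 := by simpa using hB
      omega
  · have hB3 : 3 ≤ B := by omega
    refine ih (2 * B - 3 * A).natAbs ?_ (c - d) (2 * d - c) (5 * A - 3 * B) (2 * B - 3 * A)
      (by linear_combination h) ?_ ?_ (by omega) rfl
    · have : A < B := by nlinarith
      have : B < 3 * A := by nlinarith
      omega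
    · push_cast
      rw [← hA, ← hB]
      simp [Complex.normSq_apply, h2]
      ring
    · push_cast
      rw [← hA, ← hB]
      simp [Complex.normSq_apply, h2]
      ring

lemma phiC_add_phiCσ : phiC + phiCσ = 1 := by
  unfold phiC phiCσ
  norm_cast
  ring

lemma phiC_mul_phiCσ : phiC * phiCσ = -1 := by
  have h : Real.sqrt 5 ^ 2 = 5 := Real.sq_sqrt (by norm_num)
  have h' : ((Real.sqrt 5 : ℝ) : ℂ) ^ 2 = 5 := by exact_mod_cast h
  unfold phiC phiCσ
  push_cast
  linear_combination (-1 / 4) * h'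

lemma phiC_notMem (K : Subfield ℂ) [NumberField ↥K]
    (hdeg : Module.finrank ℚ ↥K = 2) (himag : ∃ z ∈ K, Complex.im z ≠ 0) : phiC ∉ K := by
  intro hmem
  have h := normSq_eq_norm K hdeg himag ⟨phiC, hmem⟩
  have hirr : Irrational (Real.goldenRatio ^ 2) := by
    rw [Real.goldenRatio_sq]
    exact_mod_cast Real.goldenRatio_irrational.add_natCast 1
  refine hirr ⟨_, h.symm.trans ?_⟩
  change Complex.normSq (Real.goldenRatio : ℂ) = _
  rw [Complex.normSq_ofReal, pow_two]

/-- The shape of a matrix in `SL₂(𝒪_K)` that swaps `φ` and its conjugate. -/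
lemma eq_of_mobiusC_phiC (K : Subfield ℂ) [NumberField ↥K] (hmem : phiC ∉ K) (g : SL2O K)
    (h : mobiusC g phiC = phiCσ) :
    g.1 1 1 ^ 2 + g.1 1 0 * g.1 1 1 - g.1 1 0 ^ 2 = -1 := by
  have hdet : g.1 0 0 * g.1 1 1 - g.1 0 1 * g.1 1 0 = 1 := by
    rw [← Matrix.det_fin_two]
    exact g.2
  generalize ha : g.1 0 0 = a at *
  generalize hb : g.1 0 1 = b at *
  generalize hc : g.1 1 0 = c at *
  generalize hd : g.1 1 1 = d at *
  have hσ0 : phiCσ ≠ 0 := by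
    intro h0
    have := phiC_mul_phiCσ
    simp [h0] at this
  unfold mobiusC at h
  rw [ha, hb, hc, hd] at h
  have hden : ((c : ↥K) : ℂ) * phiC + ((d : ↥K) : ℂ) ≠ 0 := by
    intro h0
    rw [h0, div_zero] at h
    exact hσ0 h.symm
  rw [div_eq_iff hden] at h
  have hlin : ((a + d : ↥K) : ℂ) * phiC = ((d - c - b : ↥K) : ℂ) := by
    push_cast
    linear_combination h + ((c : ↥K) : ℂ) * phiC_mul_phiCσ + ((d : ↥K) : ℂ) * phiC_add_phiCσ
  have had : (a + d : ↥K) = 0 := by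
    by_contra hne
    apply hmem
    have hne' : ((a + d : ↥K) : ℂ) ≠ 0 := by exact_mod_cast hne
    rw [eq_div_of_mul_eq hne' ((mul_comm _ _).trans hlin)]
    exact K.div_mem (SetLike.coe_mem _) (SetLike.coe_mem _)
  have hb' : (d - c - b : ↥K) = 0 := by
    rw [had] at hlin
    have : ((d - c - b : ↥K) : ℂ) = 0 := by simpa using hlin.symm
    exact_mod_cast this
  have had2 : a + d = 0 := by exact_mod_cast had
  have hb2 : d - c - b = 0 := by exact_mod_cast hb'
  linear_combination d * had2 + c * hb2 - hdet

/-- Final remark of the paper. Let `K ⊆ ℂ` be an imaginary quadratic number field of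
discriminant `D ≠ -4`, and for a nonzero ideal `𝔞` of `𝒪_D` let
`Γ₀(𝔞) = {±(a,b;c,d) ∈ PSL₂(𝒪_D) : c ∈ 𝔞}`. Then there exists `g ∈ Γ₀(2𝒪_D)` with
`g·φ = φ^σ`, but there is no `g ∈ Γ₀(3𝒪_D)` with `g·φ = φ^σ`: the golden ratio `φ` is
`Γ₀(2𝒪_D)`-reciprocal but not `Γ₀(3𝒪_D)`-reciprocal. -/
theorem stmt19 (K : Subfield ℂ) [NumberField ↥K]
    (hdeg : Module.finrank ℚ ↥K = 2) (himag : ∃ z ∈ K, Complex.im z ≠ 0)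
    (hD4 : NumberField.discr ↥K ≠ -4) :
    (∃ g : SL2O K, g.1 1 0 ∈ Ideal.span {(2 : 𝓞 ↥K)} ∧ mobiusC g phiC = phiCσ) ∧
    ¬ (∃ g : SL2O K, g.1 1 0 ∈ Ideal.span {(3 : 𝓞 ↥K)} ∧ mobiusC g phiC = phiCσ) := by
  refine ⟨?_, ?_⟩
  · refine ⟨⟨!![-1, -1; 2, 1], by rw [Matrix.det_fin_two_of]; ring⟩,
      by simp, ?_⟩
    have hden : 2 * phiC + 1 ≠ 0 := by
      have h : (2 * ((1 + Real.sqrt 5) / 2) + 1 : ℝ) ≠ 0 := by positivity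
      unfold phiC
      exact_mod_cast h
    have h2 : (((2 : 𝓞 ↥K) : ↥K) : ℂ) = 2 := by norm_cast
    have h : (-1 * phiC + -1) / (2 * phiC + 1) = phiCσ := by
      rw [div_eq_iff hden]
      linear_combination -2 * phiC_mul_phiCσ - phiC_add_phiCσ
    simpa [mobiusC, h2] using h
  · rintro ⟨g, hg, h⟩
    have hint := exists_int_normSq K hdeg himag
    have hrel := eq_of_mobiusC_phiC K (phiC_notMem K hdeg himag) g h
    obtain ⟨e, he⟩ := Ideal.mem_span_singleton.mp hg
    rw [he] at hrel
    generalize g.1 1 1 = d at hrel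
    have h3 : (((3 : 𝓞 ↥K) : ↥K) : ℂ) = 3 := by norm_cast
    obtain ⟨p, hp⟩ := hint d
    obtain ⟨q, hq⟩ := hint e
    obtain ⟨r, hr⟩ := hint (e + d)
    obtain ⟨i, hi⟩ := exists_sq_eq_neg_one K hint _ (3 * e) d (p + 9 * q)
      (3 * (r - p + 2 * q)) hrel
      (by
        push_cast
        rw [← hp, ← hq]
        simp [Complex.normSq_apply, h3]
        ring)
      (by
        push_cast
        rw [← hp, ← hq, ← hr]
        simp [Complex.normSq_apply, h3]
        ring)
      (dvd_mul_right _ _) rfl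
    refine hD4 (discr_eq_neg_four_of_sq_eq_neg_one ↥K hdeg i ?_)
    exact_mod_cast congrArg (fun x : 𝓞 ↥K => (x : ↥K)) hi
end
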